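/- Assume λ > 0 (the graph is connected). Then every mincut X with r ∉ X has a certificate: X is the minimal mincut of some vertex, or the minimal mincut of some edge, or X is the union of a chain. -/

import Mathlib

open Finset

variable {V : Type*} [Fintype V] [DecidableEq V]

/-- `cutW w X Y` is `C(X,Y) = Σ_{x∈X} Σ_{y∈Y} w(x,y)`. -/
def cutW (w : V → V → ℝ) (X Y : Finset V) : ℝ := ∑ x ∈ X, ∑ y ∈ Y, w x y

/-- `C(X) := C(X, V ∖ X)`. -/
def cutVal (w : V → V → ℝ) (X : Finset V) : ℝ := cutW w X Xᶜ

/-- A cut is a nonempty proper subset of `V`. -/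
def IsCut (X : Finset V) : Prop := X.Nonempty ∧ X ≠ Finset.univ

/-- A mincut is a cut of minimum weight. -/
def IsMincut (w : V → V → ℝ) (X : Finset V) : Prop :=
  IsCut X ∧ ∀ Y : Finset V, IsCut Y → cutVal w X ≤ cutVal w Y

/-- `X` and `Y` cross if `X∩Y`, `X∖Y`, `Y∖X` and `V∖(X∪Y)` are all nonempty. -/
def Crosses (X Y : Finset V) : Prop :=
  (X ∩ Y).Nonempty ∧ (X \ Y).Nonempty ∧ (Y \ X).Nonempty ∧ ((X ∪ Y)ᶜ).Nonempty

/-- A minimal mincut of a vertex `v`: a mincut containing `v` but not the root `r`,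
of minimum cardinality among all such mincuts. -/
def IsMinimalMincutOfVertex (w : V → V → ℝ) (r v : V) (X : Finset V) : Prop :=
  IsMincut w X ∧ v ∈ X ∧ r ∉ X ∧
    ∀ Y : Finset V, IsMincut w Y → v ∈ Y → r ∉ Y → X.card ≤ Y.card

/-- An edge is an unordered pair of distinct vertices with positive weight. -/
def IsEdge (w : V → V → ℝ) (u₁ u₂ : V) : Prop := u₁ ≠ u₂ ∧ 0 < w u₁ u₂

/-- A minimal mincut of an edge `{u₁,u₂}`: a mincut containing both endpoints but not the
root `r`, of minimum cardinality among all such mincuts. -/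
def IsMinimalMincutOfEdge (w : V → V → ℝ) (r u₁ u₂ : V) (X : Finset V) : Prop :=
  IsEdge w u₁ u₂ ∧ IsMincut w X ∧ u₁ ∈ X ∧ u₂ ∈ X ∧ r ∉ X ∧
    ∀ Y : Finset V, IsMincut w Y → u₁ ∈ Y → u₂ ∈ Y → r ∉ Y → X.card ≤ Y.card

/-- Union of the members of a chain. -/
def chainUnion (C : List (Finset V)) : Finset V := C.foldr (· ∪ ·) ∅

/-- `X ⊆ V∖{r}` has a certificate if it is the minimal mincut of some vertex,
the minimal mincut of some edge, or the union of a chain, where a chain is a sequence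
`(C₀,…,C_ℓ)` (`ℓ ≥ 1`) of pairwise disjoint nonempty subsets of `V∖{r}` such that every
`C_i` has a certificate and each `C_i ∪ C_{i+1}` is the minimal mincut of some edge. -/
inductive HasCert (w : V → V → ℝ) (r : V) : Finset V → Prop
  | vertex {v : V} {X : Finset V} : IsMinimalMincutOfVertex w r v X → HasCert w r X
  | edge {u₁ u₂ : V} {X : Finset V} : IsMinimalMincutOfEdge w r u₁ u₂ X → HasCert w r X
  | chain {C : List (Finset V)} :
      2 ≤ C.length →
      (∀ A ∈ C, A.Nonempty) →
      (∀ A ∈ C, r ∉ A) →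
      C.Pairwise (fun A B => Disjoint A B) →
      (∀ A ∈ C, HasCert w r A) →
      (∀ i (h : i + 1 < C.length),
        ∃ u₁ u₂, IsMinimalMincutOfEdge w r u₁ u₂
          (C.get ⟨i, Nat.lt_of_succ_lt h⟩ ∪ C.get ⟨i + 1, h⟩)) →
      HasCert w r (chainUnion C)

/-- `(C₀,…,C_ℓ)` with `ℓ ≥ 1` is a chain. -/
def IsMincutChain (w : V → V → ℝ) (r : V) (C : List (Finset V)) : Prop :=
  2 ≤ C.length ∧
  (∀ A ∈ C, A.Nonempty) ∧
  (∀ A ∈ C, r ∉ A) ∧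
  C.Pairwise (fun A B => Disjoint A B) ∧
  (∀ A ∈ C, HasCert w r A) ∧
  (∀ i (h : i + 1 < C.length),
    ∃ u₁ u₂, IsMinimalMincutOfEdge w r u₁ u₂
      (C.get ⟨i, Nat.lt_of_succ_lt h⟩ ∪ C.get ⟨i + 1, h⟩))

/-- A subchain is a consecutive subsequence of a chain or of its reversal. -/
def IsSubchain (D C : List (Finset V)) : Prop := D <:+: C ∨ D <:+: C.reverse

/-- A maximal chain is a chain that is not a subchain of any strictly longer chain. -/
def IsMaximalMincutChain (w : V → V → ℝ) (r : V) (C : List (Finset V)) : Prop :=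
  IsMincutChain w r C ∧
    ¬ ∃ D : List (Finset V), IsMincutChain w r D ∧ C.length < D.length ∧ IsSubchain C D

/-- `lam` is the minimum weight of a cut. -/
def IsMincutValue (w : V → V → ℝ) (lam : ℝ) : Prop :=
  (∃ X : Finset V, IsCut X ∧ cutVal w X = lam) ∧
  ∀ X : Finset V, IsCut X → lam ≤ cutVal w X

theorem cutVal_eq_ind (w : V → V → ℝ) (X : Finset V) :
    cutVal w X = ∑ x, ∑ y, if x ∈ X ∧ y ∉ X then w x y else 0 := by
  unfold cutVal cutW
  rw [← Finset.sum_filter_add_sum_filter_not Finset.univ (fun x => x ∈ X)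
    (fun x => ∑ y, if x ∈ X ∧ y ∉ X then w x y else 0)]
  have h2 : ∑ x ∈ Finset.univ.filter (fun x => ¬ x ∈ X),
      (∑ y, if x ∈ X ∧ y ∉ X then w x y else 0) = 0 := by
    apply Finset.sum_eq_zero
    intro x hx
    apply Finset.sum_eq_zero
    intro y _
    have : x ∉ X := by simpa using hx
    simp [this]
  rw [h2, add_zero]
  have h3 : Finset.univ.filter (fun x => x ∈ X) = X := by ext; simp
  rw [h3]
  apply Finset.sum_congr rfl
  intro x hx
  have h4 : Xᶜ = Finset.univ.filter (fun y => y ∉ X) := by ext; simp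
  rw [h4, Finset.sum_filter]
  simp [hx]

theorem cutVal_compl_eq (w : V → V → ℝ) (hsym : ∀ x y, w x y = w y x) (X : Finset V) :
    cutVal w Xᶜ = cutVal w X := by
  unfold cutVal cutW
  rw [compl_compl, Finset.sum_comm]
  simp only [hsym]

theorem cutVal_submod (w : V → V → ℝ) (hnonneg : ∀ x y, 0 ≤ w x y) (X Y : Finset V) :
    cutVal w (X ∩ Y) + cutVal w (X ∪ Y) ≤ cutVal w X + cutVal w Y := by
  simp only [cutVal_eq_ind, ← Finset.sum_add_distrib]
  apply Finset.sum_le_sum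
  intro x _
  apply Finset.sum_le_sum
  intro y _
  have := hnonneg x y
  by_cases h1 : x ∈ X <;> by_cases h2 : x ∈ Y <;> by_cases h3 : y ∈ X <;> by_cases h4 : y ∈ Y <;>
    simp [h1, h2, h3, h4, this]

/-- connectivity of mincuts -/
theorem mincut_connected (w : V → V → ℝ) (hnonneg : ∀ x y, 0 ≤ w x y)
    (hsym : ∀ x y, w x y = w y x)
    (hp : ∀ X : Finset V, IsCut X → 0 < cutVal w X)
    (A B : Finset V) (hd : Disjoint A B) (hA : A.Nonempty) (hB : B.Nonempty)
    (hX : IsMincut w (A ∪ B)) : ∃ u ∈ A, ∃ v ∈ B, IsEdge w u v := by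
  by_contra hcon
  push Not at hcon
  have hz : ∀ u ∈ A, ∀ v ∈ B, w u v = 0 := by
    intro u hu v hv
    have h1 := hcon u hu v hv
    have hne : u ≠ v := fun h => Finset.disjoint_left.mp hd hu (h ▸ hv)
    by_contra hw
    exact h1 ⟨hne, lt_of_le_of_ne (hnonneg u v) (Ne.symm hw)⟩
  have hcA : IsCut A := by
    refine ⟨hA, fun h => ?_⟩
    obtain ⟨b, hb⟩ := hB
    exact Finset.disjoint_left.mp hd (h ▸ Finset.mem_univ b) hb
  have hcB : IsCut B := by
    refine ⟨hB, fun h => ?_⟩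
    obtain ⟨b, hb⟩ := hA
    exact Finset.disjoint_left.mp hd hb (h ▸ Finset.mem_univ b)
  have hle : cutVal w A + cutVal w B ≤ cutVal w (A ∪ B) := by
    simp only [cutVal_eq_ind, ← Finset.sum_add_distrib]
    apply Finset.sum_le_sum
    intro x _
    apply Finset.sum_le_sum
    intro y _
    have := hnonneg x y
    by_cases h1 : x ∈ A <;> by_cases h2 : x ∈ B
    · exact absurd h2 (Finset.disjoint_left.mp hd h1)
    · by_cases h3 : y ∈ A <;> by_cases h4 : y ∈ B <;> simp [h1, h2, h3, h4]
      exact (hz x h1 y h4).le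
    · by_cases h3 : y ∈ A <;> by_cases h4 : y ∈ B <;> simp [h1, h2, h3, h4]
      rw [hsym]
      exact (hz y h3 x h2).le
    · simp [h1, h2]
  have h1 := hX.2 A hcA
  have h2 := hp B hcB
  linarith

theorem mincut_inter_union (w : V → V → ℝ) (r : V) (hnonneg : ∀ x y, 0 ≤ w x y)
    (X Y : Finset V) (hX : IsMincut w X) (hY : IsMincut w Y) (hrX : r ∉ X) (hrY : r ∉ Y)
    (hI : (X ∩ Y).Nonempty) : IsMincut w (X ∩ Y) ∧ IsMincut w (X ∪ Y) := by
  have c1 : IsCut (X ∩ Y) := ⟨hI, fun h => by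
    have := Finset.mem_univ r
    rw [← h] at this
    simp [hrX] at this⟩
  have c2 : IsCut (X ∪ Y) := ⟨hX.1.1.mono Finset.subset_union_left, fun h => by
    have := Finset.mem_univ r
    rw [← h] at this
    simp [hrX, hrY] at this⟩
  have hs := cutVal_submod w hnonneg X Y
  have h1 := hX.2 _ c1
  have h2 := hX.2 _ c2
  have h3 := hY.2 _ c1
  have h4 := hY.2 _ c2
  refine ⟨⟨c1, fun Z hZ => ?_⟩, ⟨c2, fun Z hZ => ?_⟩⟩ <;>
  · have h5 := hX.2 Z hZ
    have h6 := hY.2 Z hZ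
    linarith

theorem mincut_sdiff (w : V → V → ℝ) (hnonneg : ∀ x y, 0 ≤ w x y)
    (hsym : ∀ x y, w x y = w y x)
    (X Y : Finset V) (hX : IsMincut w X) (hY : IsMincut w Y)
    (h1 : (X \ Y).Nonempty) (h2 : (Y \ X).Nonempty) : IsMincut w (X \ Y) := by
  have hs := cutVal_submod w hnonneg X Yᶜ
  have e1 : X ∩ Yᶜ = X \ Y := by ext; simp
  have e2 : X ∪ Yᶜ = (Y \ X)ᶜ := by ext; simp; tauto
  rw [e1, e2, cutVal_compl_eq w hsym, cutVal_compl_eq w hsym] at hs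
  have c1 : IsCut (X \ Y) := ⟨h1, fun h => by
    obtain ⟨y, hy⟩ := h2
    have := Finset.mem_univ y
    rw [← h] at this
    simp at this hy
    exact hy.2 this.1⟩
  have c2 : IsCut (Y \ X) := ⟨h2, fun h => by
    obtain ⟨y, hy⟩ := h1
    have := Finset.mem_univ y
    rw [← h] at this
    simp at this hy
    exact hy.2 this.1⟩
  refine ⟨c1, fun Z hZ => ?_⟩
  have h3 := hY.2 _ c2
  have h5 := hX.2 Z hZ
  linarith

/-- partition sequences of mincuts with adjacent unions mincuts -/
def MSeq (w : V → V → ℝ) (r : V) (X : Finset V) (C : List (Finset V)) : Prop :=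
  2 ≤ C.length ∧ (∀ A ∈ C, IsMincut w A) ∧ (∀ A ∈ C, r ∉ A) ∧
  C.Pairwise (fun A B => Disjoint A B) ∧ C.IsChain (fun A B => IsMincut w (A ∪ B)) ∧
  chainUnion C = X

theorem chainUnion_append (L R : List (Finset V)) :
    chainUnion (L ++ R) = chainUnion L ∪ chainUnion R := by
  induction L with
  | nil => simp [chainUnion]
  | cons a L ih =>
    simp only [chainUnion, List.cons_append, List.foldr_cons] at ih ⊢
    rw [ih, Finset.union_assoc]

theorem chainUnion_cons (A : Finset V) (L : List (Finset V)) :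
    chainUnion (A :: L) = A ∪ chainUnion L := rfl

theorem subset_chainUnion (L : List (Finset V)) (A : Finset V) (h : A ∈ L) :
    A ⊆ chainUnion L := by
  induction L with
  | nil => simp at h
  | cons a L ih =>
    rw [chainUnion_cons]
    rcases List.mem_cons.mp h with h | h
    · subst h; exact Finset.subset_union_left
    · exact (ih h).trans Finset.subset_union_right

theorem disjoint_chainUnion (L : List (Finset V)) (A : Finset V) (h : ∀ B ∈ L, Disjoint A B) :
    Disjoint A (chainUnion L) := by
  induction L with
  | nil => simp [chainUnion]
  | cons a L ih =>
    rw [chainUnion_cons, Finset.disjoint_union_right]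
    exact ⟨h a (by simp), ih fun B hB => h B (by simp [hB])⟩

theorem length_le_card (L : List (Finset V)) (hn : ∀ A ∈ L, A.Nonempty)
    (hd : L.Pairwise (fun A B => Disjoint A B)) : L.length ≤ (chainUnion L).card := by
  induction L with
  | nil => simp
  | cons a L ih =>
    rw [List.pairwise_cons] at hd
    rw [chainUnion_cons, Finset.card_union_of_disjoint (disjoint_chainUnion L a hd.1)]
    have h1 := ih (fun A hA => hn A (by simp [hA])) hd.2
    have h2 := (hn a (by simp)).card_pos
    simp only [List.length_cons]
    omega

/-- splitting a two-piece window: replace `A` by `A₁, A₂`. -/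
theorem MSeq_split (w : V → V → ℝ) (r : V) (X : Finset V) (L R : List (Finset V))
    (A A₁ A₂ : Finset V) (hS : MSeq w r X (L ++ A :: R))
    (hu : A₁ ∪ A₂ = A) (hd : Disjoint A₁ A₂) (h1 : IsMincut w A₁) (h2 : IsMincut w A₂)
    (hl : ∀ D ∈ L.getLast?, IsMincut w (D ∪ A₁))
    (hr : ∀ D ∈ R.head?, IsMincut w (A₂ ∪ D)) :
    MSeq w r X (L ++ A₁ :: A₂ :: R) := by
  obtain ⟨hlen, hm, hrr, hp, hc, hX⟩ := hS
  have hs1 : A₁ ⊆ A := hu ▸ Finset.subset_union_left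
  have hs2 : A₂ ⊆ A := hu ▸ Finset.subset_union_right
  have hAm := hm A (by simp)
  have hAr := hrr A (by simp)
  refine ⟨?_, ?_, ?_, ?_, ?_, ?_⟩
  · simp at hlen ⊢; omega
  · intro B hB
    simp only [List.mem_append, List.mem_cons] at hB
    rcases hB with hB | rfl | rfl | hB
    · exact hm B (by simp [hB])
    · exact h1
    · exact h2
    · exact hm B (by simp [hB])
  · intro B hB
    simp only [List.mem_append, List.mem_cons] at hB
    rcases hB with hB | rfl | rfl | hB
    · exact hrr B (by simp [hB])
    · exact fun h => hAr (hs1 h)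
    · exact fun h => hAr (hs2 h)
    · exact hrr B (by simp [hB])
  · rw [List.pairwise_append, List.pairwise_cons] at hp
    obtain ⟨p1, ⟨p2, p3⟩, p4⟩ := hp
    rw [List.pairwise_append, List.pairwise_cons, List.pairwise_cons]
    refine ⟨p1, ⟨?_, ?_, p3⟩, ?_⟩
    · intro B hB
      rcases List.mem_cons.mp hB with rfl | hB
      · exact hd
      · exact (p2 B hB).mono_left hs1
    · intro B hB
      exact (p2 B hB).mono_left hs2
    · intro D hD B hB
      simp only [List.mem_cons] at hB
      rcases hB with rfl | rfl | hB
      · exact (p4 D hD A (by simp)).mono_right hs1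
      · exact (p4 D hD A (by simp)).mono_right hs2
      · exact p4 D hD B (by simp [hB])
  · rw [List.isChain_append, List.isChain_cons] at hc
    obtain ⟨c1, ⟨c2, c3⟩, c4⟩ := hc
    rw [List.isChain_append, List.isChain_cons, List.isChain_cons]
    refine ⟨c1, ⟨?_, hr, c3⟩, ?_⟩
    · intro y hy
      simp at hy
      subst hy
      rw [hu]; exact hAm
    · intro x hx y hy
      simp at hy
      subst hy
      exact hl x hx
  · rw [← hX]
    simp only [chainUnion_append, chainUnion_cons]
    rw [← hu, Finset.union_assoc A₁ A₂]

theorem sdiff_union_aux (A B M D : Finset V) (hM : M ⊆ A ∪ B) (h1 : Disjoint A D)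
    (h2 : Disjoint B D) (Z : Finset V) : (Z ∪ D) \ M = Z \ M ∪ D := by
  ext x
  have a1 := @hM x
  have a2 : x ∈ A → x ∉ D := fun h => Finset.disjoint_left.mp h1 h
  have a3 : x ∈ B → x ∉ D := fun h => Finset.disjoint_left.mp h2 h
  simp only [Finset.mem_union, Finset.mem_sdiff] at a1 ⊢
  by_cases hD : x ∈ D <;> by_cases hm : x ∈ M <;> simp_all

/-- If a window `A, B` does not form a minimal mincut of an edge, the sequence refines. -/
theorem MSeq_refine (w : V → V → ℝ) (r : V) (hnonneg : ∀ x y, 0 ≤ w x y)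
    (hsym : ∀ x y, w x y = w y x)
    (hp : ∀ X : Finset V, IsCut X → 0 < cutVal w X)
    (X : Finset V) (L R : List (Finset V)) (A B : Finset V)
    (hS : MSeq w r X (L ++ A :: B :: R))
    (hno : ¬ ∃ u₁ u₂, IsMinimalMincutOfEdge w r u₁ u₂ (A ∪ B)) :
    ∃ C', MSeq w r X C' ∧ C'.length = (L ++ A :: B :: R).length + 1 := by
  have hS' := hS
  obtain ⟨hlen, hm, hrr, hpw, hc, hX⟩ := hS'
  have hA := hm A (by simp)
  have hB := hm B (by simp)
  have hrA := hrr A (by simp)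
  have hrB := hrr B (by simp)
  rw [List.pairwise_append, List.pairwise_cons, List.pairwise_cons] at hpw
  rw [List.isChain_append, List.isChain_cons, List.isChain_cons] at hc
  obtain ⟨-, ⟨p2, p3, -⟩, p4⟩ := hpw
  obtain ⟨-, ⟨c2, c3, -⟩, c4⟩ := hc
  have hAB := c2 B (by simp)
  have hdAB := p2 B (by simp)
  obtain ⟨u, hu, v, hv, he⟩ := mincut_connected w hnonneg hsym hp A B hdAB hA.1.1 hB.1.1 hAB
  have hrAB : r ∉ A ∪ B := by simp [hrA, hrB]
  have hY : ∃ Y, IsMincut w Y ∧ u ∈ Y ∧ v ∈ Y ∧ r ∉ Y ∧ Y.card < (A ∪ B).card := by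
    by_contra hcon
    push Not at hcon
    exact hno ⟨u, v, he, hAB, by simp [hu], by simp [hv], hrAB, hcon⟩
  obtain ⟨Y, hYm, huY, hvY, hrY, hYc⟩ := hY
  obtain ⟨M, hMdef⟩ : ∃ M, M = Y ∩ (A ∪ B) := ⟨_, rfl⟩
  have hM : IsMincut w M := by
    rw [hMdef]
    exact (mincut_inter_union w r hnonneg Y (A ∪ B) hYm hAB hrY hrAB ⟨u, by simp [hu, huY]⟩).1
  have hMs : M ⊆ A ∪ B := hMdef ▸ Finset.inter_subset_right
  have huM : u ∈ M := by simp [hMdef, hu, huY]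
  have hvM : v ∈ M := by simp [hMdef, hv, hvY]
  have hrM : r ∉ M := fun h => hrAB (hMs h)
  have hnss : ¬ A ∪ B ⊆ M := fun h => by
    have := Finset.card_le_card (h.trans (hMdef ▸ Finset.inter_subset_left : M ⊆ Y))
    omega
  have huB : u ∉ B := Finset.disjoint_left.mp hdAB hu
  have hvA : v ∉ A := Finset.disjoint_right.mp hdAB hv
  by_cases hAM : A ⊆ M
  · have hBM : ¬ B ⊆ M := fun h => hnss (Finset.union_subset hAM h)
    obtain ⟨b, hb, hbM⟩ := Finset.not_subset.mp hBM
    refine ⟨(L ++ [A]) ++ (B ∩ M) :: (B \ M) :: R, ?_, by simp; omega⟩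
    have hS2 : MSeq w r X ((L ++ [A]) ++ B :: R) := by simpa using hS
    apply MSeq_split w r X (L ++ [A]) R B _ _ hS2
    · ext x; simp; tauto
    · rw [Finset.disjoint_left]; intro x; simp; tauto
    · exact (mincut_inter_union w r hnonneg B M hB hM hrB hrM ⟨v, by simp [hv, hvM]⟩).1
    · exact mincut_sdiff w hnonneg hsym B M hB hM ⟨b, by simp [hb, hbM]⟩ ⟨u, by simp [huB, huM]⟩
    · intro D hD
      simp at hD
      subst hD
      have := (mincut_inter_union w r hnonneg A M hA hM hrA hrM ⟨u, by simp [hu, huM]⟩).2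
      convert this using 1
      ext x
      have := @hMs x
      simp at this ⊢
      tauto
    · intro D hD
      have hDm : D ∈ R := List.mem_of_mem_head? hD
      have hBD := c3 D hD
      have dAD := p2 D (by simp [hDm])
      have dBD := p3 D hDm
      have := mincut_sdiff w hnonneg hsym (B ∪ D) M hBD hM ⟨b, by simp [hb, hbM]⟩
        ⟨u, by simp [huM, huB, Finset.disjoint_left.mp dAD hu]⟩
      rwa [sdiff_union_aux A B M D hMs dAD dBD] at this
  · obtain ⟨a, ha, haM⟩ := Finset.not_subset.mp hAM
    refine ⟨L ++ (A \ M) :: (A ∩ M) :: (B :: R), ?_, by simp; omega⟩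
    apply MSeq_split w r X L (B :: R) A _ _ hS
    · ext x; simp; tauto
    · rw [Finset.disjoint_left]; intro x; simp; tauto
    · exact mincut_sdiff w hnonneg hsym A M hA hM ⟨a, by simp [ha, haM]⟩ ⟨v, by simp [hvA, hvM]⟩
    · exact (mincut_inter_union w r hnonneg A M hA hM hrA hrM ⟨u, by simp [hu, huM]⟩).1
    · intro D hD
      have hDm : D ∈ L := List.mem_of_mem_getLast? hD
      have hDA := c4 D hD A (by simp)
      have dDA := p4 D hDm A (by simp)
      have dDB := p4 D hDm B (by simp)
      have := mincut_sdiff w hnonneg hsym (D ∪ A) M hDA hM ⟨a, by simp [ha, haM]⟩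
        ⟨v, by simp [hvM, hvA, Finset.disjoint_right.mp dDB hv]⟩
      rwa [Finset.union_comm D A, sdiff_union_aux A B M D hMs dDA.symm dDB.symm,
        Finset.union_comm] at this
    · intro D hD
      simp at hD
      subst hD
      have := (mincut_inter_union w r hnonneg M B hM hB hrM hrB ⟨v, by simp [hv, hvM]⟩).2
      convert this using 1
      ext x
      have := @hMs x
      simp at this ⊢
      tauto

theorem MSeq_exists_full (w : V → V → ℝ) (r : V) (hnonneg : ∀ x y, 0 ≤ w x y)
    (hsym : ∀ x y, w x y = w y x)
    (hp : ∀ X : Finset V, IsCut X → 0 < cutVal w X)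
    (X : Finset V) (n : ℕ) : ∀ C : List (Finset V), MSeq w r X C → X.card ≤ C.length + n →
    ∃ C', MSeq w r X C' ∧ ∀ L A B R, C' = L ++ A :: B :: R →
      ∃ u₁ u₂, IsMinimalMincutOfEdge w r u₁ u₂ (A ∪ B) := by
  have hbd : ∀ C : List (Finset V), MSeq w r X C → C.length ≤ X.card := by
    intro C hC
    have := length_le_card C (fun A hA => (hC.2.1 A hA).1.1) hC.2.2.2.1
    rwa [hC.2.2.2.2.2] at this
  induction n with
  | zero =>
    intro C hC hle
    refine ⟨C, hC, fun L A B R h => ?_⟩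
    by_contra hno
    subst h
    obtain ⟨C', h1, h2⟩ := MSeq_refine w r hnonneg hsym hp X L R A B hC hno
    have := hbd C' h1
    omega
  | succ n ih =>
    intro C hC hle
    by_cases h : ∀ L A B R, C = L ++ A :: B :: R →
      ∃ u₁ u₂, IsMinimalMincutOfEdge w r u₁ u₂ (A ∪ B)
    · exact ⟨C, hC, h⟩
    · simp only [not_forall] at h
      obtain ⟨L, A, B, R, h, hno⟩ := h
      subst h
      obtain ⟨C', h1, h2⟩ := MSeq_refine w r hnonneg hsym hp X L R A B hC hno
      exact ih C' h1 (by omega)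

theorem MSeq_exists_start (w : V → V → ℝ) (r : V) (hnonneg : ∀ x y, 0 ≤ w x y)
    (hsym : ∀ x y, w x y = w y x)
    (hp : ∀ X : Finset V, IsCut X → 0 < cutVal w X)
    (X : Finset V) (hX : IsMincut w X) (hrX : r ∉ X)
    (hv : ¬ ∃ v : V, IsMinimalMincutOfVertex w r v X)
    (he : ¬ ∃ u₁ u₂ : V, IsMinimalMincutOfEdge w r u₁ u₂ X) :
    ∃ C, MSeq w r X C := by
  classical
  let S : Finset (Finset V) := Finset.univ.filter (fun A => IsMincut w A ∧ A ⊆ X ∧ A ≠ X)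
  have hSne : S.Nonempty := by
    obtain ⟨v, hvX⟩ := hX.1.1
    have : ∃ Y, IsMincut w Y ∧ v ∈ Y ∧ r ∉ Y ∧ Y.card < X.card := by
      by_contra hcon
      push Not at hcon
      exact hv ⟨v, hX, hvX, hrX, hcon⟩
    obtain ⟨Y, h1, h2, h3, h4⟩ := this
    refine ⟨Y ∩ X, ?_⟩
    simp only [S, Finset.mem_filter, Finset.mem_univ, true_and]
    refine ⟨(mincut_inter_union w r hnonneg Y X h1 hX h3 hrX ⟨v, by simp [h2, hvX]⟩).1,
      Finset.inter_subset_right, fun h => ?_⟩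
    have := Finset.card_le_card (Finset.inter_subset_left : Y ∩ X ⊆ Y)
    rw [h] at this
    omega
  obtain ⟨A, hAS, hmax⟩ := S.exists_max_image Finset.card hSne
  simp only [S, Finset.mem_filter, Finset.mem_univ, true_and] at hAS hmax
  obtain ⟨hA, hAX, hAne⟩ := hAS
  have hrA : r ∉ A := fun h => hrX (hAX h)
  have hXA : (X \ A).Nonempty := by
    rw [Finset.sdiff_nonempty]
    exact fun h => hAne (Finset.Subset.antisymm hAX h)
  obtain ⟨u, hu, v, hvv, hedge⟩ := mincut_connected w hnonneg hsym hp A (X \ A)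
    Finset.disjoint_sdiff hA.1.1 hXA (by rwa [Finset.union_sdiff_of_subset hAX])
  simp only [Finset.mem_sdiff] at hvv
  have : ∃ Y, IsMincut w Y ∧ u ∈ Y ∧ v ∈ Y ∧ r ∉ Y ∧ Y.card < X.card := by
    by_contra hcon
    push Not at hcon
    exact he ⟨u, v, hedge, hX, hAX hu, hvv.1, hrX, hcon⟩
  obtain ⟨Y, h1, h2, h2', h3, h4⟩ := this
  obtain ⟨M, hMdef⟩ : ∃ M, M = Y ∩ X := ⟨_, rfl⟩
  have hM : IsMincut w M := by
    rw [hMdef]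
    exact (mincut_inter_union w r hnonneg Y X h1 hX h3 hrX ⟨u, by simp [h2, hAX hu]⟩).1
  have hMX : M ⊆ X := hMdef ▸ Finset.inter_subset_right
  have hMY : M ⊆ Y := hMdef ▸ Finset.inter_subset_left
  have hrM : r ∉ M := fun h => hrX (hMX h)
  have huM : u ∈ M := by simp [hMdef, h2, hAX hu]
  have hvM : v ∈ M := by simp [hMdef, h2', hvv.1]
  have hU : IsMincut w (A ∪ M) :=
    (mincut_inter_union w r hnonneg A M hA hM hrA hrM ⟨u, by simp [hu, huM]⟩).2
  have hUX : A ∪ M = X := by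
    by_contra hne
    have hc := hmax (A ∪ M) ⟨hU, Finset.union_subset hAX hMX, hne⟩
    have : A = A ∪ M := Finset.eq_of_subset_of_card_le Finset.subset_union_left hc
    exact hvv.2 (this ▸ Finset.mem_union_right A hvM)
  have hAM : (A \ M).Nonempty := by
    rw [Finset.sdiff_nonempty]
    intro h
    rw [Finset.union_eq_right.mpr h] at hUX
    have := Finset.card_le_card hMY
    rw [hUX] at this
    omega
  have hMA : IsMincut w (M \ A) :=
    mincut_sdiff w hnonneg hsym M A hM hA ⟨v, by simp [hvM, hvv.2]⟩ hAM
  refine ⟨[A, M \ A], by simp, ?_, ?_, ?_, ?_, ?_⟩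
  · simp [hA, hMA]
  · simp [hrA, hrM]
  · simp [Finset.disjoint_sdiff]
  · simpa using hU
  · simpa [chainUnion] using hUX

theorem mincut_cert_aux (r : V) (w : V → V → ℝ) (hnonneg : ∀ x y, 0 ≤ w x y)
    (hsym : ∀ x y, w x y = w y x)
    (hp : ∀ X : Finset V, IsCut X → 0 < cutVal w X) (n : ℕ) :
    ∀ X : Finset V, X.card ≤ n → IsMincut w X → r ∉ X →
    (∃ v : V, IsMinimalMincutOfVertex w r v X) ∨
    (∃ u₁ u₂ : V, IsMinimalMincutOfEdge w r u₁ u₂ X) ∨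
    (∃ C : List (Finset V), IsMincutChain w r C ∧ chainUnion C = X) := by
  induction n with
  | zero =>
    intro X hc hX _
    have := hX.1.1.card_pos
    omega
  | succ n ih =>
    intro X hc hX hrX
    by_cases hv : ∃ v : V, IsMinimalMincutOfVertex w r v X
    · exact Or.inl hv
    by_cases he : ∃ u₁ u₂ : V, IsMinimalMincutOfEdge w r u₁ u₂ X
    · exact Or.inr (Or.inl he)
    right; right
    obtain ⟨C₀, hC₀⟩ := MSeq_exists_start w r hnonneg hsym hp X hX hrX hv he
    obtain ⟨C, hC, hfull⟩ := MSeq_exists_full w r hnonneg hsym hp X X.card C₀ hC₀ (by omega)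
    obtain ⟨hlen, hm, hrr, hpw, hch, hXu⟩ := hC
    refine ⟨C, ⟨hlen, fun A hA => (hm A hA).1.1, hrr, hpw, ?_, ?_⟩, hXu⟩
    · intro A hA
      have hsub : A.card ≤ n := by
        obtain ⟨L, R, rfl⟩ := List.append_of_mem hA
        have hB : ∃ B ∈ L ++ R, B ∈ L ++ A :: R ∧ Disjoint A B := by
          rw [List.pairwise_append, List.pairwise_cons] at hpw
          rcases L with _ | ⟨B, L⟩
          · rcases R with _ | ⟨B, R⟩
            · simp at hlen
            · exact ⟨B, by simp, by simp, hpw.2.1.1 B (by simp)⟩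
          · exact ⟨B, by simp, by simp, (hpw.2.2 B (by simp) A (by simp)).symm⟩
        obtain ⟨B, -, hB, hd⟩ := hB
        have h1 := subset_chainUnion _ A hA
        have h2 := subset_chainUnion _ B hB
        rw [hXu] at h1 h2
        have h3 := Finset.card_le_card (Finset.union_subset h1 h2)
        rw [Finset.card_union_of_disjoint hd] at h3
        have h4 := (hm B hB).1.1.card_pos
        omega
      rcases ih A hsub (hm A hA) (hrr A hA) with ⟨v, h⟩ | ⟨u₁, u₂, h⟩ | ⟨D, ⟨d1, d2, d3, d4, d5, d6⟩, hD⟩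
      · exact HasCert.vertex h
      · exact HasCert.edge h
      · rw [← hD]
        exact HasCert.chain d1 d2 d3 d4 d5 d6
    · intro i h
      apply hfull (C.take i) _ _ (C.drop (i + 2))
      have h1 : C.drop i = C[i] :: C.drop (i + 1) := List.drop_eq_getElem_cons (by omega)
      have h2 : C.drop (i + 1) = C[i + 1] :: C.drop (i + 2) := List.drop_eq_getElem_cons h
      simp only [List.get_eq_getElem]
      rw [← h2, ← h1, List.take_append_drop]


/-- if `λ > 0`, every mincut `X` with `r ∉ X` has a certificate: it is the
minimal mincut of some vertex, or of some edge, or the union of a chain. -/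
theorem every_mincut_has_certificate
    (r : V) (w : V → V → ℝ)
    (hcard : 1 < Fintype.card V)
    (hsym : ∀ x y, w x y = w y x)
    (hnonneg : ∀ x y, 0 ≤ w x y)
    (hdiag : ∀ x, w x x = 0)
    (lam : ℝ) (hlam : IsMincutValue w lam) (hpos : 0 < lam)
    (X : Finset V) (hX : IsMincut w X) (hrX : r ∉ X) :
    (∃ v : V, IsMinimalMincutOfVertex w r v X) ∨
    (∃ u₁ u₂ : V, IsMinimalMincutOfEdge w r u₁ u₂ X) ∨
    (∃ C : List (Finset V), IsMincutChain w r C ∧ chainUnion C = X) := by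
  exact mincut_cert_aux r w hnonneg hsym
    (fun Y hY => lt_of_lt_of_le hpos (hlam.2 Y hY)) X.card X le_rfl hX hrX
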